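/- The closure, the interior, and each connected component of a semialgebraic subset of $\mathbb{R}^n$ are semialgebraic; moreover, a semialgebraic set has only finitely many connected components. -/

import Mathlib

/-- Semialgebraic subsets of `ℝⁿ`: finite Boolean combinations of sets
`{x : g(x) > 0}` with `g` a polynomial. -/
inductive IsSemialgebraic {n : ℕ} : Set (Fin n → ℝ) → Prop
  | basic (g : MvPolynomial (Fin n) ℝ) :
      IsSemialgebraic {x : Fin n → ℝ | 0 < MvPolynomial.eval x g}
  | inter {s t : Set (Fin n → ℝ)} : IsSemialgebraic s → IsSemialgebraic t →
      IsSemialgebraic (s ∩ t)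
  | compl {s : Set (Fin n → ℝ)} : IsSemialgebraic s → IsSemialgebraic sᶜ

namespace SAlg

open Polynomial Filter Topology Set

variable {n : ℕ}

/-! ### Boolean calculus -/

/-- A predicate on `ℝⁿ` is semialgebraic. -/
def SA (p : (Fin n → ℝ) → Prop) : Prop := IsSemialgebraic {x | p x}

lemma SA.congr {p q : (Fin n → ℝ) → Prop} (h : SA p) (e : ∀ x, q x ↔ p x) : SA q := by
  have : q = p := funext fun x => propext (e x)
  rw [this]; exact h

lemma SA.not {p : (Fin n → ℝ) → Prop} (h : SA p) : SA (fun x => ¬ p x) :=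
  IsSemialgebraic.compl h

lemma SA.and {p q : (Fin n → ℝ) → Prop} (hp : SA p) (hq : SA q) : SA (fun x => p x ∧ q x) :=
  IsSemialgebraic.inter hp hq

lemma SA.or {p q : (Fin n → ℝ) → Prop} (hp : SA p) (hq : SA q) : SA (fun x => p x ∨ q x) :=
  (hp.not.and hq.not).not.congr fun x => by tauto

lemma SA.imp {p q : (Fin n → ℝ) → Prop} (hp : SA p) (hq : SA q) : SA (fun x => p x → q x) :=
  (hp.not.or hq).congr fun x => by tauto

lemma SA.iff {p q : (Fin n → ℝ) → Prop} (hp : SA p) (hq : SA q) : SA (fun x => p x ↔ q x) :=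
  ((hp.imp hq).and (hq.imp hp)).congr fun x => by tauto

lemma SA.pos (g : MvPolynomial (Fin n) ℝ) : SA (fun x => 0 < MvPolynomial.eval x g) :=
  IsSemialgebraic.basic g

lemma SA.const (p : Prop) : SA (fun _ : Fin n → ℝ => p) := by
  by_cases hp : p
  · exact (SA.pos 1).congr fun x => by simp [hp]
  · exact (SA.pos 0).congr fun x => by simp [hp]

lemma SA.eq0 (g : MvPolynomial (Fin n) ℝ) : SA (fun x => MvPolynomial.eval x g = 0) :=
  ((SA.pos g).or (SA.pos (-g))).not.congr fun x => by
    simp only [map_neg, not_or, not_lt, Left.neg_pos_iff]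
    constructor
    · intro h; simp [h]
    · rintro ⟨h1, h2⟩; exact le_antisymm h1 h2

lemma SA.bex {ι : Type*} {s : Set ι} (hs : s.Finite) {p : ι → (Fin n → ℝ) → Prop}
    (h : ∀ i ∈ s, SA (p i)) : SA (fun x => ∃ i ∈ s, p i x) := by
  induction s, hs using Set.Finite.induction_on with
  | empty => exact (SA.const False).congr fun x => by simp
  | @insert a s _ _ ih =>
    refine ((h a (by simp)).or (ih fun i hi => h i (by simp [hi]))).congr fun x => by simp

lemma SA.ex {ι : Type*} [Finite ι] {p : ι → (Fin n → ℝ) → Prop}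
    (h : ∀ i, SA (p i)) : SA (fun x => ∃ i, p i x) :=
  (SA.bex (Set.finite_univ (α := ι)) fun i _ => h i).congr fun x => by simp

lemma SA.all {ι : Type*} [Finite ι] {p : ι → (Fin n → ℝ) → Prop}
    (h : ∀ i, SA (p i)) : SA (fun x => ∀ i, p i x) :=
  (SA.ex fun i => (h i).not).not.congr fun x => by simp

lemma SA.ball {ι : Type*} {s : Set ι} (hs : s.Finite) {p : ι → (Fin n → ℝ) → Prop}
    (h : ∀ i ∈ s, SA (p i)) : SA (fun x => ∀ i ∈ s, p i x) :=
  (SA.bex hs fun i hi => (h i hi).not).not.congr fun x => by simp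

lemma SA.preimage {m k : ℕ} {p : (Fin m → ℝ) → Prop} (hp : SA p)
    (φ : Fin m → MvPolynomial (Fin k) ℝ) :
    SA (fun x : Fin k → ℝ => p (fun i => MvPolynomial.eval x (φ i))) := by
  have key : ∀ S : Set (Fin m → ℝ), IsSemialgebraic S →
      SA (fun x : Fin k → ℝ => (fun i => MvPolynomial.eval x (φ i)) ∈ S) := by
    intro S hS
    induction hS with
    | basic g =>
      refine (SA.pos (MvPolynomial.bind₁ φ g)).congr fun x => ?_
      simp only [Set.mem_ofPred_eq]
      have := MvPolynomial.aeval_bind₁ (R := ℝ) x φ g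
      simp only [MvPolynomial.aeval_eq_eval] at this
      exact (congrArg (fun t : ℝ => 0 < t) this.symm).to_iff
    | inter _ _ h1 h2 => exact h1.and h2
    | compl _ h => exact h.not
  exact key _ hp

/-- Semialgebraic relations on `ℝⁿ × ℝ`. -/
def SA2 (T : (Fin n → ℝ) → ℝ → Prop) : Prop :=
  SA (fun z : Fin (n + 1) → ℝ => T (Fin.tail z) (z 0))

lemma SA.lift {p : (Fin n → ℝ) → Prop} (hp : SA p) : SA2 (fun x _ => p x) := by
  have := hp.preimage (k := n + 1) (fun i => MvPolynomial.X i.succ)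
  refine this.congr fun x => ?_
  simp only [MvPolynomial.eval_X]; rfl

lemma SA2.congr {p q : (Fin n → ℝ) → ℝ → Prop} (h : SA2 p) (e : ∀ x y, q x y ↔ p x y) : SA2 q :=
  SA.congr h fun _ => e _ _

lemma SA2.of_set {S : Set (Fin (n + 1) → ℝ)} (hS : IsSemialgebraic S) :
    SA2 (fun x y => (Fin.cons y x : Fin (n + 1) → ℝ) ∈ S) := by
  refine SA.congr (p := fun z => z ∈ S) hS fun z => ?_
  simp

/-- specialization of a polynomial with polynomial coefficients -/
noncomputable abbrev ev (P : (MvPolynomial (Fin n) ℝ)[X]) (x : Fin n → ℝ) : ℝ[X] :=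
  P.map (MvPolynomial.eval x)

lemma ev_finSucc (g : MvPolynomial (Fin (n + 1)) ℝ) (x : Fin n → ℝ) (y : ℝ) :
    (ev (MvPolynomial.finSuccEquiv ℝ n g) x).eval y
      = MvPolynomial.eval (Fin.cons y x : Fin (n + 1) → ℝ) g :=
  (MvPolynomial.eval_eq_eval_mv_eval' x y g).symm

lemma ev_symm (P : (MvPolynomial (Fin n) ℝ)[X]) (x : Fin n → ℝ) (y : ℝ) :
    (ev P x).eval y = MvPolynomial.eval (Fin.cons y x : Fin (n + 1) → ℝ)
      ((MvPolynomial.finSuccEquiv ℝ n).symm P) := by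
  rw [← ev_finSucc]; simp

lemma SA2.pos (P : (MvPolynomial (Fin n) ℝ)[X]) : SA2 (fun x y => 0 < (ev P x).eval y) := by
  refine (SA.pos ((MvPolynomial.finSuccEquiv ℝ n).symm P)).congr fun z => ?_
  simp only [ev_symm]; simp

lemma SA2.neg (P : (MvPolynomial (Fin n) ℝ)[X]) : SA2 (fun x y => (ev P x).eval y < 0) :=
  (SA2.pos (-P)).congr fun x y => by simp

lemma SA2.eq0 (P : (MvPolynomial (Fin n) ℝ)[X]) : SA2 (fun x y => (ev P x).eval y = 0) := by
  refine (SA.eq0 ((MvPolynomial.finSuccEquiv ℝ n).symm P)).congr fun z => ?_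
  simp only [ev_symm]; simp

lemma SA_ev_ne (P : (MvPolynomial (Fin n) ℝ)[X]) : SA (fun x => ev P x ≠ 0) := by
  refine (SA.bex (Set.finite_Iic P.natDegree) (p := fun i x => ¬ MvPolynomial.eval x (P.coeff i) = 0)
    fun i _ => (SA.eq0 _).not).congr fun x => ?_
  constructor
  · intro h
    by_contra hc
    push Not at hc
    apply h
    ext i
    by_cases hi : i ≤ P.natDegree
    · simpa using hc i hi
    · simp [Polynomial.coeff_eq_zero_of_natDegree_lt (not_le.1 hi)]
  · rintro ⟨i, -, hi⟩ h
    apply hi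
    have := congrArg (fun q => q.coeff i) h
    simpa using this

lemma SA_natDegree_le (P : (MvPolynomial (Fin n) ℝ)[X]) (e : ℕ) :
    SA (fun x => (ev P x).natDegree ≤ e) := by
  refine (SA.ball (Set.finite_Ioc e P.natDegree)
    (p := fun i x => MvPolynomial.eval x (P.coeff i) = 0) fun i _ => SA.eq0 _).congr fun x => ?_
  rw [Polynomial.natDegree_le_iff_coeff_eq_zero]
  constructor
  · intro h i hi
    simpa using h i hi.1
  · intro h i hi
    by_cases hi' : i ≤ P.natDegree
    · simpa using h i ⟨hi, hi'⟩
    · simp [Polynomial.coeff_eq_zero_of_natDegree_lt (not_le.1 hi')]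

lemma SA_natDegree_eq (P : (MvPolynomial (Fin n) ℝ)[X]) (e : ℕ) :
    SA (fun x => (ev P x).natDegree = e) := by
  rcases e with _ | e
  · exact (SA_natDegree_le P 0).congr fun x => by simp
  · exact ((SA_natDegree_le P (e + 1)).and (SA_natDegree_le P e).not).congr fun x => by omega

lemma SA_leadingCoeff_pos (P : (MvPolynomial (Fin n) ℝ)[X]) :
    SA (fun x => 0 < (ev P x).leadingCoeff) := by
  refine (SA.bex (Set.finite_Iic P.natDegree)
    (p := fun e x => (ev P x).natDegree = e ∧ 0 < MvPolynomial.eval x (P.coeff e))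
    fun i _ => (SA_natDegree_eq _ _).and (SA.pos _)).congr fun x => ?_
  constructor
  · intro h
    refine ⟨(ev P x).natDegree, Polynomial.natDegree_map_le, rfl, ?_⟩
    have h1 : (ev P x).coeff (ev P x).natDegree
      = MvPolynomial.eval x (P.coeff (ev P x).natDegree) := Polynomial.coeff_map _ _
    rw [← h1]; exact h
  · rintro ⟨i, -, hi, h⟩
    rw [Polynomial.leadingCoeff, hi, Polynomial.coeff_map]
    exact h

/-! ### Real polynomial lemmas -/

lemma cont (p : ℝ[X]) : Continuous fun y => p.eval y := p.continuous

/-- No zero of `p` in `[a,b]` implies same sign. -/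
lemma same_sign {p : ℝ[X]} {a b : ℝ} (h : ∀ c ∈ uIcc a b, p.eval c ≠ 0) :
    0 < p.eval a ↔ 0 < p.eval b := by
  have := intermediate_value_uIcc (f := fun y => p.eval y) (a := a) (b := b)
    (cont p).continuousOn
  by_contra hc
  have h0 : (0 : ℝ) ∈ uIcc (p.eval a) (p.eval b) := by
    rw [Set.mem_uIcc]
    by_cases ha : 0 < p.eval a <;> by_cases hb : 0 < p.eval b
    · simp [ha, hb] at hc
    · right; exact ⟨not_lt.1 hb, ha.le⟩
    · left; exact ⟨not_lt.1 ha, hb.le⟩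
    · simp [ha, hb] at hc
  obtain ⟨c, hc, hc0⟩ := this h0
  exact h c hc hc0

lemma mono_or_anti {p : ℝ[X]} {a b : ℝ}
    (h : ∀ c ∈ Ioo a b, (derivative p).eval c ≠ 0) :
    StrictMonoOn (fun y => p.eval y) (Icc a b) ∨ StrictAntiOn (fun y => p.eval y) (Icc a b) := by
  have := hasDerivWithinAt_forall_lt_or_forall_gt_of_forall_ne (convex_Ioo a b)
    (f := fun y => p.eval y) (f' := fun y => (derivative p).eval y) (m := 0)
    (fun x _ => (p.hasDerivAt x).hasDerivWithinAt) h
  rcases this with h | h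
  · right
    refine strictAntiOn_of_deriv_neg (convex_Icc a b) (cont p).continuousOn fun x hx => ?_
    rw [interior_Icc] at hx
    simpa using h x hx
  · left
    refine strictMonoOn_of_deriv_pos (convex_Icc a b) (cont p).continuousOn fun x hx => ?_
    rw [interior_Icc] at hx
    simpa using h x hx

lemma exists_root {p : ℝ[X]} {a b : ℝ} (hab : a ≤ b) (ha : p.eval a < 0) (hb : 0 < p.eval b) :
    ∃ c ∈ Ioo a b, p.eval c = 0 :=
  intermediate_value_Ioo hab (cont p).continuousOn ⟨ha, hb⟩

lemma right_tri (p : ℝ[X]) (a : ℝ) :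
    p = 0 ∨ (∀ᶠ y in 𝓝[>] a, 0 < p.eval y) ∨ (∀ᶠ y in 𝓝[>] a, p.eval y < 0) := by
  by_cases hp : p = 0
  · left; exact hp
  right
  obtain ⟨q, hq, hd⟩ := Polynomial.exists_eq_pow_rootMultiplicity_mul_and_not_dvd p hp a
  have hqa : q.eval a ≠ 0 := by
    intro h; exact hd (Polynomial.dvd_iff_isRoot.2 h)
  have hpos : ∀ᶠ y in 𝓝[>] a, a < y := eventually_mem_nhdsWithin
  rcases lt_or_gt_of_ne hqa with h | h
  · right
    have : ∀ᶠ y in 𝓝[>] a, q.eval y < 0 :=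
      nhdsWithin_le_nhds ((cont q).continuousAt.eventually_lt_const h)
    filter_upwards [this, hpos] with y h1 h2
    rw [hq]
    simp only [eval_mul, eval_pow, eval_sub, eval_X, eval_C]
    exact mul_neg_of_pos_of_neg (pow_pos (sub_pos.2 h2) _) h1
  · left
    have : ∀ᶠ y in 𝓝[>] a, 0 < q.eval y :=
      nhdsWithin_le_nhds ((cont q).continuousAt.eventually_const_lt h)
    filter_upwards [this, hpos] with y h1 h2
    rw [hq]
    simp only [eval_mul, eval_pow, eval_sub, eval_X, eval_C]
    exact mul_pos (pow_pos (sub_pos.2 h2) _) h1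

lemma right_of_deriv {p : ℝ[X]} {a : ℝ} (h0 : p.eval a = 0)
    (h : ∀ᶠ y in 𝓝[>] a, 0 < (derivative p).eval y) : ∀ᶠ y in 𝓝[>] a, 0 < p.eval y := by
  obtain ⟨b, hb, hs⟩ := mem_nhdsGT_iff_exists_Ioo_subset.1 h
  filter_upwards [Ioo_mem_nhdsGT hb] with y hy
  have : StrictMonoOn (fun y => p.eval y) (Icc a y) := by
    refine strictMonoOn_of_deriv_pos (convex_Icc a y) (cont p).continuousOn fun x hx => ?_
    rw [interior_Icc] at hx
    have := hs (show x ∈ Ioo a b from ⟨hx.1, hx.2.trans hy.2⟩)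
    simpa using this
  have := this (left_mem_Icc.2 hy.1.le) (right_mem_Icc.2 hy.1.le) hy.1
  simpa [h0] using this

lemma right_iff (p : ℝ[X]) (a : ℝ) : (∀ᶠ y in 𝓝[>] a, 0 < p.eval y) ↔
    0 < p.eval a ∨ (p.eval a = 0 ∧ ∀ᶠ y in 𝓝[>] a, 0 < (derivative p).eval y) := by
  constructor
  · intro h
    rcases lt_trichotomy (p.eval a) 0 with ha | ha | ha
    · exfalso
      have : ∀ᶠ y in 𝓝[>] a, p.eval y < 0 :=
        nhdsWithin_le_nhds ((cont p).continuousAt.eventually_lt_const ha)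
      obtain ⟨y, h1, h2⟩ := (h.and this).exists
      linarith
    · right
      refine ⟨ha, ?_⟩
      rcases right_tri (derivative p) a with h' | h' | h'
      · exfalso
        obtain ⟨y, hy⟩ := h.exists
        rw [Polynomial.eq_C_of_derivative_eq_zero h'] at hy ha
        simp at hy ha
        linarith
      · exact h'
      · exfalso
        have : ∀ᶠ y in 𝓝[>] a, 0 < (-p).eval y := by
          apply right_of_deriv (by simp [ha])
          simpa using h'
        obtain ⟨y, h1, h2⟩ := (h.and this).exists
        simp at h2
        linarith
    · left; exact ha
  · rintro (h | ⟨h0, h⟩)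
    · exact nhdsWithin_le_nhds ((cont p).continuousAt.eventually_const_lt h)
    · exact right_of_deriv h0 h

lemma top_of_lc {p : ℝ[X]} (h : 0 < p.leadingCoeff) : ∀ᶠ y in atTop, 0 < p.eval y := by
  by_cases hd : 0 < p.degree
  · exact (Polynomial.tendsto_atTop_of_leadingCoeff_nonneg p hd h.le).eventually_gt_atTop 0
  · rw [Polynomial.eq_C_of_degree_le_zero (not_lt.1 hd)] at h ⊢
    simp only [leadingCoeff_C] at h
    simp only [eval_C]
    exact Eventually.of_forall fun _ => h

lemma top_tri (p : ℝ[X]) :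
    p = 0 ∨ (∀ᶠ y in atTop, 0 < p.eval y) ∨ (∀ᶠ y in atTop, p.eval y < 0) := by
  rcases lt_trichotomy p.leadingCoeff 0 with h | h | h
  · right; right
    have := top_of_lc (p := -p) (by simpa using h)
    simpa using this
  · left; exact Polynomial.leadingCoeff_eq_zero.1 h
  · right; left; exact top_of_lc h

lemma top_iff (p : ℝ[X]) : (∀ᶠ y in atTop, 0 < p.eval y) ↔ 0 < p.leadingCoeff := by
  refine ⟨fun h => ?_, top_of_lc⟩
  by_contra hc
  rcases (not_lt.1 hc).lt_or_eq with h' | h'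
  · have := top_of_lc (p := -p) (by simpa using h')
    obtain ⟨y, h1, h2⟩ := (h.and this).exists
    simp at h2; linarith
  · rw [Polynomial.leadingCoeff_eq_zero.1 h'] at h
    obtain ⟨y, h1⟩ := h.exists
    simp at h1

lemma bot_iff (q : ℝ → Prop) : (∀ᶠ y in atBot, q y) ↔ ∀ᶠ y in atTop, q (-y) := by
  rw [← Filter.map_neg_atTop, Filter.eventually_map]

/-! ### Places -/

/-- A place: a semialgebraic family of filters deciding polynomial signs. -/
structure Place (g : (Fin n → ℝ) → Filter ℝ) : Prop where
  dec : ∀ x (p : ℝ[X]), (∀ᶠ y in g x, 0 < p.eval y) ∨ (∀ᶠ y in g x, ¬ 0 < p.eval y)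
  ne : ∀ x, (g x).NeBot
  sa : ∀ P : (MvPolynomial (Fin n) ℝ)[X], SA (fun x => ∀ᶠ y in g x, 0 < (ev P x).eval y)

lemma Place.set_aux {g : (Fin n → ℝ) → Filter ℝ} (hg : Place g) {S : Set (Fin (n + 1) → ℝ)}
    (hS : IsSemialgebraic S) :
    (∀ x, (∀ᶠ y in g x, (Fin.cons y x : Fin (n + 1) → ℝ) ∈ S) ∨
      (∀ᶠ y in g x, ¬ (Fin.cons y x : Fin (n + 1) → ℝ) ∈ S)) ∧
    SA (fun x => ∀ᶠ y in g x, (Fin.cons y x : Fin (n + 1) → ℝ) ∈ S) := by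
  induction hS with
  | basic f =>
    simp only [Set.mem_ofPred_eq, ← ev_finSucc]
    exact ⟨fun x => hg.dec x _, hg.sa _⟩
  | inter _ _ h1 h2 =>
    refine ⟨fun x => ?_, (h1.2.and h2.2).congr fun x => by simp [Filter.eventually_and]⟩
    rcases h1.1 x with a | a
    · rcases h2.1 x with b | b
      · left; filter_upwards [a, b] with y ha hb using ⟨ha, hb⟩
      · right; filter_upwards [b] with y hb using fun h => hb h.2
    · right; filter_upwards [a] with y ha using fun h => ha h.1
  | compl _ h =>
    refine ⟨fun x => ?_, h.2.not.congr fun x => ?_⟩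
    · rcases h.1 x with a | a
      · right; filter_upwards [a] with y ha using fun h => h ha
      · left; exact a
    · have := hg.ne x
      constructor
      · intro h1 h2
        obtain ⟨y, a, b⟩ := (h1.and h2).exists
        exact a b
      · intro h1
        exact (h.1 x).resolve_left h1

lemma Place.dec2 {g : (Fin n → ℝ) → Filter ℝ} (hg : Place g) {T : (Fin n → ℝ) → ℝ → Prop}
    (hT : SA2 T) (x : Fin n → ℝ) : (∀ᶠ y in g x, T x y) ∨ (∀ᶠ y in g x, ¬ T x y) := by
  have := (hg.set_aux hT).1 x
  simpa using this

lemma Place.sa2 {g : (Fin n → ℝ) → Filter ℝ} (hg : Place g) {T : (Fin n → ℝ) → ℝ → Prop}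
    (hT : SA2 T) : SA (fun x => ∀ᶠ y in g x, T x y) := by
  have := (hg.set_aux hT).2
  simpa using this

lemma Place.top : Place (fun _ : Fin n → ℝ => (atTop : Filter ℝ)) where
  dec x p := by
    rcases top_tri p with h | h | h
    · right; simp [h]
    · left; exact h
    · right; filter_upwards [h] with y hy using hy.le.not_gt
  ne x := inferInstance
  sa P := (SA_leadingCoeff_pos P).congr fun x => top_iff _

lemma Place.bot : Place (fun _ : Fin n → ℝ => (atBot : Filter ℝ)) where
  dec x p := by
    have := (Place.top (n := n)).dec x (p.comp (-X))
    simp only [eval_comp, eval_neg, eval_X] at this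
    simpa only [bot_iff] using this
  ne x := inferInstance
  sa P := (SA_leadingCoeff_pos (P.comp (-X))).congr fun x => by
    rw [bot_iff, ← top_iff]
    simp [ev, Polynomial.map_comp]

lemma Place.right {ξ : (Fin n → ℝ) → ℝ} (h : Place (fun x => pure (ξ x))) :
    Place (fun x => 𝓝[>] (ξ x)) where
  dec x p := by
    rcases right_tri p (ξ x) with h | h | h
    · right; simp [h]
    · left; exact h
    · right; filter_upwards [h] with y hy using hy.le.not_gt
  ne x := inferInstance
  sa P := by
    induction hd : P.natDegree using Nat.strong_induction_on generalizing P with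
    | _ d ih =>
      by_cases h0 : P.natDegree = 0
      · refine (h.sa P).congr fun x => ?_
        rw [Polynomial.eq_C_of_natDegree_eq_zero h0]
        simp [ev]
      · have := ih _ (by rw [← hd]; exact Polynomial.natDegree_derivative_lt h0) (derivative P) rfl
        refine ((h.sa P).or ((h.sa2 (SA2.eq0 P)).and this)).congr fun x => ?_
        rw [right_iff]
        simp [ev, Polynomial.derivative_map]

/-! ### Semialgebraic functions and cuts -/

/-- Semialgebraic functions, in the form needed for root functions. -/
structure SAFun (ξ : (Fin n → ℝ) → ℝ) : Prop where
  pl : Place (fun x => pure (ξ x))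
  lt : SA2 (fun x y => y < ξ x)
  eq : SA2 (fun x y => y = ξ x)

lemma Place.mk_pure {ξ : (Fin n → ℝ) → ℝ}
    (h : ∀ P : (MvPolynomial (Fin n) ℝ)[X], SA (fun x => 0 < (ev P x).eval (ξ x))) :
    Place (fun x => pure (ξ x)) where
  dec x p := by simp only [eventually_pure]; exact em _
  ne x := inferInstance
  sa P := (h P).congr fun x => by simp only [eventually_pure]

lemma SAFun.at {ξ : (Fin n → ℝ) → ℝ} (h : SAFun ξ) {T : (Fin n → ℝ) → ℝ → Prop} (hT : SA2 T) :
    SA (fun x => T x (ξ x)) :=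
  (h.pl.sa2 hT).congr fun x => by simp only [eventually_pure]

lemma gt_of {ξ : (Fin n → ℝ) → ℝ} (hl : SA2 (fun x y => y < ξ x)) (he : SA2 (fun x y => y = ξ x)) :
    SA2 (fun x y => ξ x < y) :=
  SA.congr ((SA.not hl).and (SA.not he)) fun z => by
    constructor
    · intro h; exact ⟨h.le.not_gt, h.ne'⟩
    · rintro ⟨h1, h2⟩; exact lt_of_le_of_ne (not_lt.1 h1) (Ne.symm h2)

lemma SAFun.zero : SAFun (fun _ : Fin n → ℝ => (0 : ℝ)) where
  pl := Place.mk_pure fun P => (SA.pos (P.coeff 0)).congr fun x => by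
    rw [← Polynomial.coeff_zero_eq_eval_zero, Polynomial.coeff_map]
  lt := (SA2.neg X).congr fun x y => by simp [ev]
  eq := (SA2.eq0 X).congr fun x y => by simp [ev]

variable {κ : Type}

/-- the upper set to the right of a cut -/
def cU (ξ : κ → (Fin n → ℝ) → ℝ) : Option κ → (Fin n → ℝ) → Set ℝ
  | none, _ => univ
  | some i, x => Ioi (ξ i x)

/-- the germ at a cut -/
def cG (ξ : κ → (Fin n → ℝ) → ℝ) : Option κ → (Fin n → ℝ) → Filter ℝ
  | none, _ => atBot
  | some i, x => 𝓝[>] (ξ i x)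

/-- the interval to the right of a cut -/
def J (ξ : κ → (Fin n → ℝ) → ℝ) (α : Option κ) (x : Fin n → ℝ) : Set ℝ :=
  {y | y ∈ cU ξ α x ∧ ∀ j, ξ j x ∈ cU ξ α x → y < ξ j x}

lemma cU_upper (ξ : κ → (Fin n → ℝ) → ℝ) (α : Option κ) (x : Fin n → ℝ) {a b : ℝ} (hab : a ≤ b)
    (ha : a ∈ cU ξ α x) : b ∈ cU ξ α x := by
  cases α with
  | none => trivial
  | some i => exact lt_of_lt_of_le (show ξ i x < a from ha) hab

lemma cG_place {ξ : κ → (Fin n → ℝ) → ℝ} (h : ∀ i, SAFun (ξ i)) (α : Option κ) :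
    Place (cG ξ α) := by
  cases α with
  | none => exact Place.bot
  | some i => exact (h i).pl.right

lemma cG_U (ξ : κ → (Fin n → ℝ) → ℝ) (α : Option κ) (x : Fin n → ℝ) :
    ∀ᶠ t in cG ξ α x, t ∈ cU ξ α x := by
  cases α with
  | none => exact Eventually.of_forall fun _ => trivial
  | some i => exact eventually_mem_nhdsWithin

lemma cG_lt (ξ : κ → (Fin n → ℝ) → ℝ) (α : Option κ) (x : Fin n → ℝ) {y : ℝ}
    (hy : y ∈ cU ξ α x) : ∀ᶠ t in cG ξ α x, t < y := by
  cases α with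
  | none => exact eventually_lt_atBot y
  | some i =>
    have : ξ i x < y := hy
    exact nhdsWithin_le_nhds (eventually_lt_nhds this)

lemma cG_J [Finite κ] (ξ : κ → (Fin n → ℝ) → ℝ) (α : Option κ) (x : Fin n → ℝ) :
    ∀ᶠ t in cG ξ α x, t ∈ J ξ α x := by
  refine (cG_U ξ α x).and ?_
  rw [Filter.eventually_all]
  intro j
  by_cases hj : ξ j x ∈ cU ξ α x
  · filter_upwards [cG_lt ξ α x hj] with t ht _ using ht
  · exact Eventually.of_forall fun t h => absurd h hj

lemma J_conn {ξ : κ → (Fin n → ℝ) → ℝ} {α : Option κ} {x : Fin n → ℝ} {a b c : ℝ}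
    (ha : a ∈ J ξ α x) (hb : b ∈ J ξ α x) (h1 : a ≤ c) (h2 : c ≤ b) : c ∈ J ξ α x :=
  ⟨cU_upper ξ α x h1 ha.1, fun j hj => lt_of_le_of_lt h2 (hb.2 j hj)⟩

lemma J_ord {ξ : κ → (Fin n → ℝ) → ℝ} {α : Option κ} {x : Fin n → ℝ} :
    OrdConnected (J ξ α x) := ⟨fun _ ha _ hb _ hc => J_conn ha hb hc.1 hc.2⟩

lemma J_not {ξ : κ → (Fin n → ℝ) → ℝ} {α : Option κ} {x : Fin n → ℝ} (j : κ) :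
    ξ j x ∉ J ξ α x := fun h => lt_irrefl _ (h.2 j h.1)

lemma J_cover [Finite κ] (ξ : κ → (Fin n → ℝ) → ℝ) (x : Fin n → ℝ) (y : ℝ) :
    (∃ j, y = ξ j x) ∨ ∃ α, y ∈ J ξ α x := by
  by_cases h : ∃ j, y = ξ j x
  · left; exact h
  right
  push Not at h
  by_cases hn : ∃ j, ξ j x < y
  · have hfin : {j | ξ j x < y}.Finite := Set.toFinite _
    obtain ⟨i, hi, hmax⟩ := Set.exists_max_image _ (fun j => ξ j x) hfin hn
    refine ⟨some i, hi, fun j hj => ?_⟩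
    by_contra hc
    have hj' : ξ j x < y := lt_of_le_of_ne (not_lt.1 hc) (Ne.symm (h j))
    exact absurd (hmax j hj') (not_le.2 hj)
  · push Not at hn
    exact ⟨none, trivial, fun j _ => lt_of_le_of_ne (hn j) (h j)⟩

lemma cU_sa {ξ : κ → (Fin n → ℝ) → ℝ} (h : ∀ i, SAFun (ξ i)) (α : Option κ) :
    SA2 (fun x y => y ∈ cU ξ α x) := by
  cases α with
  | none => exact (SA.const True).congr fun _ => by simp [cU]
  | some i => exact gt_of (h i).lt (h i).eq

lemma J_sa [Finite κ] {ξ : κ → (Fin n → ℝ) → ℝ} (h : ∀ i, SAFun (ξ i)) (α : Option κ) :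
    SA2 (fun x y => y ∈ J ξ α x) :=
  SA.and (cU_sa h α) (SA.all fun j => SA.imp ((h j).at (cU_sa h α)).lift (h j).lt)

/-- If `T x` is constant on each `J`, it is decided by the places. -/
lemma decide_iff [Finite κ] {ξ : κ → (Fin n → ℝ) → ℝ} (h : ∀ i, SAFun (ξ i)) {T : ℝ → Prop}
    {x : Fin n → ℝ} (hT : ∀ α, ∀ y ∈ J ξ α x, ∀ t ∈ J ξ α x, (T y → T t)) (y : ℝ) :
    T y ↔ (∃ j, y = ξ j x ∧ T (ξ j x)) ∨ ∃ α, y ∈ J ξ α x ∧ ∀ᶠ t in cG ξ α x, T t := by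
  constructor
  · intro hy
    rcases J_cover ξ x y with ⟨j, rfl⟩ | ⟨α, hα⟩
    · left; exact ⟨j, rfl, hy⟩
    · right
      refine ⟨α, hα, ?_⟩
      filter_upwards [cG_J ξ α x] with t ht using hT α y hα t ht hy
  · rintro (⟨j, rfl, hj⟩ | ⟨α, hα, hg⟩)
    · exact hj
    · have := (cG_place h α).ne x
      obtain ⟨t, h1, h2⟩ := (hg.and (cG_J ξ α x)).exists
      exact hT α t h2 y hα h1

/-- the functions `ξ` cover the roots of `f` -/
def Covers (ξ : κ → (Fin n → ℝ) → ℝ) (f : (MvPolynomial (Fin n) ℝ)[X]) : Prop :=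
  ∀ x, ev f x ≠ 0 → ∀ y, (ev f x).eval y = 0 → ∃ j, y = ξ j x

lemma J_sign {ξ : κ → (Fin n → ℝ) → ℝ} {f : (MvPolynomial (Fin n) ℝ)[X]} {x : Fin n → ℝ}
    (hc : ev f x ≠ 0 → ∀ y, (ev f x).eval y = 0 → ∃ j, y = ξ j x) {α : Option κ}
    {y t : ℝ} (hy : y ∈ J ξ α x) (ht : t ∈ J ξ α x) :
    0 < (ev f x).eval y ↔ 0 < (ev f x).eval t := by
  by_cases h0 : ev f x = 0
  · rw [h0]; simp
  · apply same_sign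
    intro c hcc h
    obtain ⟨j, rfl⟩ := hc h0 c h
    exact J_not j (J_ord.uIcc_subset hy ht hcc)

lemma sign_at [Finite κ] {ξ : κ → (Fin n → ℝ) → ℝ} (h : ∀ i, SAFun (ξ i))
    {r : (MvPolynomial (Fin n) ℝ)[X]} (hc : Covers ξ r) {ζ : (Fin n → ℝ) → ℝ}
    (hl : SA2 (fun x y => y < ζ x)) (he : SA2 (fun x y => y = ζ x)) :
    SA (fun x => 0 < (ev r x).eval (ζ x)) := by
  have hlt : ∀ j, SA (fun x => ξ j x < ζ x) := fun j => (h j).at hl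
  have heq : ∀ j, SA (fun x => ξ j x = ζ x) := fun j => (h j).at he
  have hgt : ∀ j, SA (fun x => ζ x < ξ j x) := fun j => (h j).at (gt_of hl he)
  have hU : ∀ α, SA (fun x => ζ x ∈ cU ξ α x) := by
    intro α
    cases α with
    | none => exact (SA.const True).congr fun _ => by simp [cU]
    | some i => exact hlt i
  have hJ : ∀ α, SA (fun x => ζ x ∈ J ξ α x) := fun α =>
    (hU α).and (SA.all fun j => ((h j).at (cU_sa h α)).imp (hgt j))
  refine ((SA.ex fun j => (heq j).and ((h j).at (SA2.pos r))).or
    (SA.ex fun α => (hJ α).and ((cG_place h α).sa r))).congr fun x => ?_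
  rw [decide_iff h (T := fun y => 0 < (ev r x).eval y)
    (fun α y hy t ht => (J_sign (hc x) hy ht).1) (ζ x)]
  simp only [eq_comm]

lemma pseudo_div {R : Type*} [CommRing R] (f : R[X]) (e : ℕ) (hf : f.natDegree ≤ e) (he : 1 ≤ e)
    (g : R[X]) : ∃ (k : ℕ) (q r : R[X]), C (f.coeff e ^ k) * g = q * f + r ∧ r.natDegree < e := by
  induction hd : g.natDegree using Nat.strong_induction_on generalizing g with
  | _ m ih =>
    by_cases hm : m < e
    · exact ⟨0, 0, g, by simp, by omega⟩
    · push Not at hm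
      set g' := C (f.coeff e) * g - C (g.coeff m) * X ^ (m - e) * f with hg'
      have h1 : g'.natDegree ≤ m := by
        refine (Polynomial.natDegree_sub_le _ _).trans (max_le ?_ ?_)
        · exact (Polynomial.natDegree_C_mul_le _ _).trans hd.le
        · rw [mul_assoc]
          refine (Polynomial.natDegree_C_mul_le _ _).trans
            (Polynomial.natDegree_mul_le.trans ?_)
          have := Polynomial.natDegree_X_pow_le (R := R) (m - e)
          omega
      have h2 : g'.coeff m = 0 := by
        have : (X ^ (m - e) * f).coeff m = f.coeff e := by
          conv_lhs => rw [show m = e + (m - e) by omega]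
          rw [show e + (m - e) - e = m - e by omega, mul_comm, Polynomial.coeff_mul_X_pow]
        rw [hg', Polynomial.coeff_sub, mul_assoc, Polynomial.coeff_C_mul, Polynomial.coeff_C_mul,
          this]
        ring
      have h3 : g'.natDegree < m := by
        by_cases h0 : g' = 0
        · rw [h0]; simp; omega
        · refine lt_of_le_of_ne h1 fun h => h0 ?_
          rw [← Polynomial.leadingCoeff_eq_zero, Polynomial.leadingCoeff, h, h2]
      obtain ⟨k, q, r, h, hr⟩ := ih _ h3 g' rfl
      refine ⟨k + 1, q + C (f.coeff e ^ k) * (C (g.coeff m) * X ^ (m - e)), r, ?_, hr⟩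
      have : C (f.coeff e ^ (k + 1)) * g
          = C (f.coeff e ^ k) * g' + C (f.coeff e ^ k) * (C (g.coeff m) * X ^ (m - e) * f) := by
        rw [hg', pow_succ, C_mul]; ring
      rw [this, h]; ring

/-- truncation -/
noncomputable def tr (f : (MvPolynomial (Fin n) ℝ)[X]) (e : ℕ) : (MvPolynomial (Fin n) ℝ)[X] :=
  ∑ i ∈ Finset.range (e + 1), C (f.coeff i) * X ^ i

lemma tr_natDegree (f : (MvPolynomial (Fin n) ℝ)[X]) (e : ℕ) : (tr f e).natDegree ≤ e := by
  apply Polynomial.natDegree_sum_le_of_forall_le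
  intro i hi
  have := Finset.mem_range.1 hi
  exact (Polynomial.natDegree_C_mul_X_pow_le _ _).trans (by omega)

lemma tr_coeff (f : (MvPolynomial (Fin n) ℝ)[X]) (e : ℕ) : (tr f e).coeff e = f.coeff e := by
  simp [tr, Polynomial.coeff_C_mul, Polynomial.coeff_X_pow]

lemma tr_ev {f : (MvPolynomial (Fin n) ℝ)[X]} {e : ℕ} {x : Fin n → ℝ}
    (h : (ev f x).natDegree = e) : ev (tr f e) x = ev f x := by
  conv_rhs => rw [Polynomial.as_sum_range_C_mul_X_pow (ev f x), h]
  simp [tr, ev, Polynomial.map_sum]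

/-- Root covers exist for all polynomials of degree at most `d`. -/
def HasCov (n d : ℕ) : Prop :=
  ∀ f : (MvPolynomial (Fin n) ℝ)[X], f.natDegree ≤ d →
    ∃ (κ : Type) (_ : Finite κ) (ξ : κ → (Fin n → ℝ) → ℝ), (∀ i, SAFun (ξ i)) ∧ Covers ξ f

lemma place_of_root {d : ℕ} (H : HasCov n d) {f : (MvPolynomial (Fin n) ℝ)[X]}
    (hf : f.natDegree ≤ d + 1) {ζ : (Fin n → ℝ) → ℝ} (hl : SA2 (fun x y => y < ζ x))
    (he : SA2 (fun x y => y = ζ x)) {E : (Fin n → ℝ) → Prop} (hE : SA E)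
    (h1 : ∀ x, E x → ev f x ≠ 0 ∧ (ev f x).eval (ζ x) = 0) (h2 : ∀ x, ¬ E x → ζ x = 0) :
    Place (fun x => pure (ζ x)) := by
  apply Place.mk_pure
  intro g
  have key : ∀ e ∈ Icc 1 (d + 1),
      SA (fun x => E x ∧ (ev f x).natDegree = e ∧ 0 < (ev g x).eval (ζ x)) := by
    rintro e ⟨he1, he2⟩
    obtain ⟨k, q, r, hq, hr⟩ := pseudo_div (tr f e) e (tr_natDegree f e) he1 g
    rw [tr_coeff] at hq
    set r' := C (f.coeff e ^ k) * r with hr'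
    have hr'd : r'.natDegree ≤ d := by
      have := Polynomial.natDegree_C_mul_le (f.coeff e ^ k) r
      rw [hr']
      omega
    obtain ⟨κ, _, ξ, hξ, hc⟩ := H r' hr'd
    have := sign_at hξ hc hl he
    refine (hE.and ((SA_natDegree_eq f e).and this)).congr fun x => ?_
    refine and_congr_right fun hx => and_congr_right fun hd => ?_
    obtain ⟨hf0, hz⟩ := h1 x hx
    have hq' := congrArg (fun p => (ev p x).eval (ζ x)) hq
    simp only [ev, Polynomial.map_mul, Polynomial.map_add, Polynomial.map_C, eval_mul, eval_add,
      eval_C] at hq'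
    have htr := tr_ev hd
    simp only [ev] at htr hz
    rw [htr, hz, mul_zero, zero_add] at hq'
    have ha : MvPolynomial.eval x (f.coeff e ^ k) ≠ 0 := by
      rw [map_pow]
      apply pow_ne_zero
      have : (ev f x).leadingCoeff ≠ 0 := Polynomial.leadingCoeff_ne_zero.2 hf0
      rw [Polynomial.leadingCoeff, hd, Polynomial.coeff_map] at this
      exact this
    rw [hr']
    simp only [ev, Polynomial.map_mul, Polynomial.map_C, eval_mul, eval_C]
    rw [← hq', ← mul_assoc]
    exact (mul_pos_iff_of_pos_left (mul_self_pos.2 ha)).symm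
  refine ((SA.bex (Set.finite_Icc 1 (d + 1)) key).or
    (hE.not.and (SAFun.zero.at (SA2.pos g)))).congr fun x => ?_
  constructor
  · intro h
    by_cases hx : E x
    · left
      obtain ⟨hf0, hz⟩ := h1 x hx
      refine ⟨(ev f x).natDegree, ⟨?_, ?_⟩, hx, rfl, h⟩
      · by_contra hc
        have h0 : (ev f x).natDegree = 0 := by omega
        rw [Polynomial.eq_C_of_natDegree_eq_zero h0] at hz hf0
        simp only [eval_C] at hz
        rw [hz] at hf0
        simp at hf0
      · exact Polynomial.natDegree_map_le.trans hf
    · right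
      rw [h2 x hx] at h
      exact ⟨hx, h⟩
  · rintro (⟨e, -, -, -, h⟩ | ⟨hx, h⟩)
    · exact h
    · rw [h2 x hx]; exact h

/-- Existence condition for a root of `f` in `J ξ α x` preceded by negative values. -/
def RootCond (ξ : κ → (Fin n → ℝ) → ℝ) (α : Option κ) (f : (MvPolynomial (Fin n) ℝ)[X])
    (x : Fin n → ℝ) : Prop :=
  (∀ᶠ t in cG ξ α x, (ev f x).eval t < 0) ∧ ∃ y ∈ J ξ α x, (ev f x).eval y = 0

open Classical in
/-- the root function -/
noncomputable def rootFun (ξ : κ → (Fin n → ℝ) → ℝ) (α : Option κ)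
    (f : (MvPolynomial (Fin n) ℝ)[X]) (x : Fin n → ℝ) : ℝ :=
  if h : RootCond ξ α f x then h.2.choose else 0

lemma rootFun_spec {ξ : κ → (Fin n → ℝ) → ℝ} {α : Option κ} {f : (MvPolynomial (Fin n) ℝ)[X]}
    {x : Fin n → ℝ} (h : RootCond ξ α f x) :
    rootFun ξ α f x ∈ J ξ α x ∧ (ev f x).eval (rootFun ξ α f x) = 0 := by
  rw [rootFun, dif_pos h]; exact h.2.choose_spec

/-- The derivative has no zeros on `J`. -/
lemma deriv_ne {ξ : κ → (Fin n → ℝ) → ℝ} {α : Option κ} {f : (MvPolynomial (Fin n) ℝ)[X]}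
    (hc : Covers ξ (derivative f)) {x : Fin n → ℝ} (h0 : derivative (ev f x) ≠ 0) {c : ℝ}
    (hcJ : c ∈ J ξ α x) : (derivative (ev f x)).eval c ≠ 0 := by
  intro h
  simp only [ev, Polynomial.derivative_map] at h h0
  obtain ⟨j, rfl⟩ := hc x h0 c h
  exact J_not j hcJ

lemma deriv_ne_zero {p : ℝ[X]} {a b : ℝ} (ha : p.eval a = 0) (hb : p.eval b ≠ 0) :
    derivative p ≠ 0 := by
  intro h
  rw [Polynomial.eq_C_of_derivative_eq_zero h] at ha hb
  simp at ha hb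
  exact hb ha

section
variable [Finite κ] {ξ : κ → (Fin n → ℝ) → ℝ} {α : Option κ} {f : (MvPolynomial (Fin n) ℝ)[X]}
  {x : Fin n → ℝ}

lemma exists_start (hξ : ∀ i, SAFun (ξ i)) (h : ∀ᶠ t in cG ξ α x, (ev f x).eval t < 0) {y : ℝ}
    (hy : y ∈ cU ξ α x) : ∃ a ∈ J ξ α x, a < y ∧ (ev f x).eval a < 0 := by
  have := (cG_place hξ α).ne x
  obtain ⟨a, h1, h2, h3⟩ := ((cG_J ξ α x).and ((cG_lt ξ α x hy).and h)).exists
  exact ⟨a, h1, h2, h3⟩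

lemma root_mono (hξ : ∀ i, SAFun (ξ i)) (hc : Covers ξ (derivative f))
    (h : ∀ᶠ t in cG ξ α x, (ev f x).eval t < 0) {r : ℝ} (hr : r ∈ J ξ α x)
    (hr0 : (ev f x).eval r = 0) {y : ℝ} (hy : y ∈ cU ξ α x)
    (hJ : ∀ c ∈ cU ξ α x, c < y → c ∈ J ξ α x) :
    ((ev f x).eval y < 0 ↔ y < r) ∧ ((ev f x).eval y = 0 ↔ y = r) := by
  obtain ⟨a, haJ, ham, ha⟩ := exists_start hξ h
    (show min y r ∈ cU ξ α x by rcases min_choice y r with e | e <;> rw [e]; exacts [hy, hr.1])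
  have hay : a < y := ham.trans_le (min_le_left _ _)
  have har : a < r := ham.trans_le (min_le_right _ _)
  have hd := deriv_ne_zero hr0 ha.ne
  have hm : StrictMonoOn (fun t => (ev f x).eval t) (Icc a (max y r)) := by
    have := mono_or_anti (p := ev f x) (a := a) (b := max y r) (by
      intro c hcc
      apply deriv_ne (α := α) hc hd
      rcases lt_max_iff.1 hcc.2 with h' | h'
      · exact hJ c (cU_upper _ _ _ hcc.1.le haJ.1) h'
      · exact J_conn haJ hr hcc.1.le h'.le)
    rcases this with h' | h'
    · exact h'
    · exfalso
      have := h' (left_mem_Icc.2 (hay.le.trans (le_max_left _ _))) ⟨har.le, le_max_right _ _⟩ har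
      simp only [hr0] at this
      linarith
  have hyI : y ∈ Icc a (max y r) := ⟨hay.le, le_max_left _ _⟩
  have hrI : r ∈ Icc a (max y r) := ⟨har.le, le_max_right _ _⟩
  have e1 := hm.lt_iff_lt hyI hrI
  have e2 := hm.injOn.eq_iff hyI hrI
  simp only [hr0] at e1 e2
  exact ⟨e1, e2⟩

lemma root_mono_J (hξ : ∀ i, SAFun (ξ i)) (hc : Covers ξ (derivative f))
    (h : ∀ᶠ t in cG ξ α x, (ev f x).eval t < 0) {r : ℝ} (hr : r ∈ J ξ α x)
    (hr0 : (ev f x).eval r = 0) {y : ℝ} (hy : y ∈ J ξ α x) :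
    ((ev f x).eval y < 0 ↔ y < r) ∧ ((ev f x).eval y = 0 ↔ y = r) :=
  root_mono hξ hc h hr hr0 hy.1
    fun _ hcU hcy => ⟨hcU, fun j hj => hcy.trans (hy.2 j hj)⟩

lemma rootCond_iff (hξ : ∀ i, SAFun (ξ i)) (hc : Covers ξ (derivative f)) :
    RootCond ξ α f x ↔ (∀ᶠ t in cG ξ α x, (ev f x).eval t < 0) ∧
      ((∃ j, ξ j x ∈ cU ξ α x ∧ (∀ l, ξ l x ∈ cU ξ α x → ¬ ξ l x < ξ j x) ∧
          0 < (ev f x).eval (ξ j x)) ∨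
        ((∀ j, ¬ ξ j x ∈ cU ξ α x) ∧ ∀ᶠ t in atTop, 0 < (ev f x).eval t)) := by
  refine and_congr_right fun h => ?_
  constructor
  · rintro ⟨r, hr, hr0⟩
    by_cases hn : ∃ j, ξ j x ∈ cU ξ α x
    · left
      have hfin : {j | ξ j x ∈ cU ξ α x}.Finite := Set.toFinite _
      obtain ⟨j, hj, hmin⟩ := Set.exists_min_image _ (fun j => ξ j x) hfin hn
      refine ⟨j, hj, fun l hl => not_lt.2 (hmin l hl), ?_⟩
      have := root_mono (y := ξ j x) hξ hc h hr hr0 hj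
        (fun c hcU hcj => ⟨hcU, fun l hl => hcj.trans_le (hmin l hl)⟩)
      have hlt : r < ξ j x := hr.2 j hj
      rcases lt_trichotomy ((ev f x).eval (ξ j x)) 0 with h' | h' | h'
      · exact absurd (this.1.1 h') hlt.le.not_gt
      · exact absurd (this.2.1 h') hlt.ne'
      · exact h'
    · right
      push Not at hn
      refine ⟨hn, ?_⟩
      filter_upwards [eventually_gt_atTop r] with y hy
      have := root_mono_J hξ hc h hr hr0 (y := y)
        ⟨cU_upper _ _ _ hy.le hr.1, fun j hj => absurd hj (hn j)⟩
      rcases lt_trichotomy ((ev f x).eval y) 0 with h' | h' | h'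
      · exact absurd (this.1.1 h') hy.le.not_gt
      · exact absurd (this.2.1 h') hy.ne'
      · exact h'
  · rintro (⟨j, hj, hmin, hpos⟩ | ⟨hn, htop⟩)
    · obtain ⟨a, haJ, hay, ha⟩ := exists_start hξ h hj
      obtain ⟨c, hcI, hc0⟩ := exists_root hay.le ha hpos
      exact ⟨c, ⟨cU_upper _ _ _ hcI.1.le haJ.1,
        fun l hl => hcI.2.trans_le (not_lt.1 (hmin l hl))⟩, hc0⟩
    · have := (cG_place hξ α).ne x
      obtain ⟨a, haJ, ha⟩ := ((cG_J ξ α x).and h).exists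
      obtain ⟨b, hb, hab⟩ := (htop.and (eventually_gt_atTop a)).exists
      obtain ⟨c, hcI, hc0⟩ := exists_root hab.le ha hb
      exact ⟨c, ⟨cU_upper _ _ _ hcI.1.le haJ.1, fun j hj => absurd hj (hn j)⟩, hc0⟩

lemma rootCond_sa (hξ : ∀ i, SAFun (ξ i)) (hc : Covers ξ (derivative f)) :
    SA (RootCond ξ α f) := by
  refine (((cG_place hξ α).sa2 (SA2.neg f)).and ((SA.ex fun j => ((hξ j).at (cU_sa hξ α)).and
    ((SA.all fun l => ((hξ l).at (cU_sa hξ α)).imp ((hξ l).at (hξ j).lt).not).and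
      ((hξ j).at (SA2.pos f)))).or ((SA.all fun j => ((hξ j).at (cU_sa hξ α)).not).and
        (Place.top.sa f)))).congr fun x => rootCond_iff hξ hc

lemma rootFun_sa {d : ℕ} (H : HasCov n d) (hf : f.natDegree ≤ d + 1) (hξ : ∀ i, SAFun (ξ i))
    (hc : Covers ξ (derivative f)) : SAFun (rootFun ξ α f) := by
  have hE : SA (RootCond ξ α f) := rootCond_sa hξ hc
  have hz : ∀ x, ¬ RootCond ξ α f x → rootFun ξ α f x = 0 := fun x hx => by
    rw [rootFun, dif_neg hx]
  have hlt : SA2 (fun x y => y < rootFun ξ α f x) := by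
    refine SA.congr ((hE.lift.and ((SA.not (cU_sa hξ α)).or ((J_sa hξ α).and (SA2.neg f)))).or
      (hE.lift.not.and SAFun.zero.lt)) fun z => ?_
    set x := Fin.tail z
    set y := z 0
    by_cases hx : RootCond ξ α f x
    · obtain ⟨hr, hr0⟩ := rootFun_spec hx
      simp only [hx, true_and, not_true_eq_false, false_and, or_false]
      constructor
      · intro hy
        by_cases hU : y ∈ cU ξ α x
        · right
          have hJ : y ∈ J ξ α x := ⟨hU, fun j hj => hy.trans (hr.2 j hj)⟩
          exact ⟨hJ, (root_mono_J hξ hc hx.1 hr hr0 hJ).1.2 hy⟩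
        · left; exact hU
      · rintro (hU | ⟨hJ, hy⟩)
        · by_contra hcc
          exact hU (cU_upper _ _ _ (not_lt.1 hcc) hr.1)
        · exact (root_mono_J hξ hc hx.1 hr hr0 hJ).1.1 hy
    · simp [hx, hz x hx]
  have heq : SA2 (fun x y => y = rootFun ξ α f x) := by
    refine SA.congr ((hE.lift.and ((J_sa hξ α).and (SA2.eq0 f))).or
      (hE.lift.not.and SAFun.zero.eq)) fun z => ?_
    set x := Fin.tail z
    set y := z 0
    by_cases hx : RootCond ξ α f x
    · obtain ⟨hr, hr0⟩ := rootFun_spec hx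
      simp only [hx, true_and, not_true_eq_false, false_and, or_false]
      constructor
      · intro hy
        rw [hy]; exact ⟨hr, hr0⟩
      · rintro ⟨hJ, hy⟩
        exact (root_mono_J hξ hc hx.1 hr hr0 hJ).2.1 hy
    · simp [hx, hz x hx]
  refine ⟨place_of_root H hf hlt heq hE (fun x hx => ?_) hz, hlt, heq⟩
  refine ⟨fun h0 => ?_, (rootFun_spec hx).2⟩
  have := (cG_place hξ α).ne x
  obtain ⟨t, ht⟩ := hx.1.exists
  rw [h0] at ht
  simp at ht

end

theorem hasCov (n d : ℕ) : HasCov n d := by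
  induction d with
  | zero =>
    intro f hf
    refine ⟨Empty, inferInstance, fun i => i.elim, fun i => i.elim, ?_⟩
    intro x h0 y hy
    exfalso
    have : (ev f x).natDegree = 0 := by
      have := (Polynomial.natDegree_map_le (p := f) (f := MvPolynomial.eval x)).trans hf
      simpa using this
    rw [Polynomial.eq_C_of_natDegree_eq_zero this] at hy h0
    simp only [eval_C] at hy
    rw [hy] at h0
    simp at h0
  | succ d H =>
    intro f hf
    obtain ⟨κ, _, ξ, hξ, hc⟩ := H (derivative f)
      ((Polynomial.natDegree_derivative_le f).trans (by omega))
    have hc' : Covers ξ (derivative (-f)) := by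
      intro x h0 y hy
      apply hc x
      · intro h; apply h0; simpa [ev] using h
      · simpa [ev] using hy
    refine ⟨κ ⊕ (Option κ ⊕ Option κ), inferInstance,
      Sum.elim ξ (Sum.elim (fun α => rootFun ξ α f) (fun α => rootFun ξ α (-f))), ?_, ?_⟩
    · rintro (i | α | α)
      · exact hξ i
      · exact rootFun_sa H hf hξ hc
      · exact rootFun_sa H (by simpa using hf) hξ hc'
    · intro x h0 y hy
      rcases J_cover ξ x y with ⟨j, rfl⟩ | ⟨α, hα⟩
      · exact ⟨Sum.inl j, rfl⟩
      have hneg : ∀ t, (ev (-f) x).eval t = -(ev f x).eval t := fun t => by simp [ev]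
      have hy' : (ev (-f) x).eval y = 0 := by rw [hneg, hy, neg_zero]
      rcases (cG_place hξ α).dec2 (SA2.neg f) x with h | h
      · refine ⟨Sum.inr (Sum.inl α), ?_⟩
        have hx : RootCond ξ α f x := ⟨h, y, hα, hy⟩
        obtain ⟨hr, hr0⟩ := rootFun_spec hx
        exact (root_mono_J hξ hc h hr hr0 hα).2.1 hy
      rcases (cG_place hξ α).dec2 (SA2.neg (-f)) x with h' | h'
      · refine ⟨Sum.inr (Sum.inr α), ?_⟩
        have hx : RootCond ξ α (-f) x := ⟨h', y, hα, hy'⟩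
        obtain ⟨hr, hr0⟩ := rootFun_spec hx
        exact (root_mono_J hξ hc' h' hr hr0 hα).2.1 hy'
      exfalso
      have := (cG_place hξ α).ne x
      obtain ⟨a, ⟨ha1, ha2⟩, haJ, hay⟩ :=
        ((h.and h').and ((cG_J ξ α x).and (cG_lt ξ α x hα.1))).exists
      rw [hneg] at ha2
      have ha : (ev f x).eval a = 0 := by linarith
      have hd : derivative (ev f x) ≠ 0 := by
        intro hd
        rw [Polynomial.eq_C_of_derivative_eq_zero hd] at hy h0
        simp only [eval_C] at hy
        rw [hy] at h0
        simp at h0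
      have := mono_or_anti (p := ev f x) (a := a) (b := y)
        (fun c hcc => deriv_ne (α := α) hc hd (J_conn haJ hα hcc.1.le hcc.2.le))
      rcases this with hm | hm
      · have := hm (left_mem_Icc.2 hay.le) (right_mem_Icc.2 hay.le) hay
        simp only [ha, hy] at this
        exact lt_irrefl _ this
      · have := hm (left_mem_Icc.2 hay.le) (right_mem_Icc.2 hay.le) hay
        simp only [ha, hy] at this
        exact lt_irrefl _ this

/-! ### Projection -/

/-- `F` is a sign family for `S` -/
def SignFam (S : Set (Fin (n + 1) → ℝ)) (F : Set (MvPolynomial (Fin n) ℝ)[X]) : Prop :=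
  ∀ (x : Fin n → ℝ) (y t : ℝ), (∀ f ∈ F, (0 < (ev f x).eval y ↔ 0 < (ev f x).eval t)) →
    ((Fin.cons y x : Fin (n + 1) → ℝ) ∈ S ↔ (Fin.cons t x : Fin (n + 1) → ℝ) ∈ S)

lemma exists_signFam {S : Set (Fin (n + 1) → ℝ)} (hS : IsSemialgebraic S) :
    ∃ F : Set (MvPolynomial (Fin n) ℝ)[X], F.Finite ∧ SignFam S F := by
  induction hS with
  | basic g =>
    refine ⟨{MvPolynomial.finSuccEquiv ℝ n g}, Set.finite_singleton _, ?_⟩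
    intro x y t h
    simp only [Set.mem_ofPred_eq, ← ev_finSucc]
    exact h _ rfl
  | inter _ _ h1 h2 =>
    obtain ⟨F, hF, h1⟩ := h1
    obtain ⟨G, hG, h2⟩ := h2
    refine ⟨F ∪ G, hF.union hG, fun x y t h => ?_⟩
    exact and_congr (h1 x y t fun f hf => h f (Or.inl hf)) (h2 x y t fun f hf => h f (Or.inr hf))
  | compl _ h =>
    obtain ⟨F, hF, h⟩ := h
    exact ⟨F, hF, fun x y t h' => not_congr (h x y t h')⟩

lemma exists_cover {F : Set (MvPolynomial (Fin n) ℝ)[X]} (hF : F.Finite) :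
    ∃ (κ : Type) (_ : Finite κ) (ξ : κ → (Fin n → ℝ) → ℝ), (∀ i, SAFun (ξ i)) ∧
      ∀ f ∈ F, Covers ξ f := by
  have : ∀ f : (MvPolynomial (Fin n) ℝ)[X],
    ∃ (κ : Type) (_ : Finite κ) (ξ : κ → (Fin n → ℝ) → ℝ), (∀ i, SAFun (ξ i)) ∧ Covers ξ f :=
    fun f => hasCov n _ f le_rfl
  choose κ hκ ξ hξ hc using this
  have := hF.to_subtype
  refine ⟨Σ f : F, κ f.1, inferInstance, fun i => ξ i.1.1 i.2, fun i => hξ _ _, ?_⟩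
  intro f hf x h0 y hy
  obtain ⟨j, hj⟩ := hc f x h0 y hy
  exact ⟨⟨⟨f, hf⟩, j⟩, hj⟩

lemma SignFam.J {S : Set (Fin (n + 1) → ℝ)} {F : Set (MvPolynomial (Fin n) ℝ)[X]}
    (h : SignFam S F) {ξ : κ → (Fin n → ℝ) → ℝ} {x : Fin n → ℝ}
    (hc : ∀ f ∈ F, ev f x ≠ 0 → ∀ y, (ev f x).eval y = 0 → ∃ j, y = ξ j x)
    (α : Option κ) (y : ℝ) (hy : y ∈ J ξ α x) (t : ℝ) (ht : t ∈ J ξ α x)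
    (hyS : (Fin.cons y x : Fin (n + 1) → ℝ) ∈ S) : (Fin.cons t x : Fin (n + 1) → ℝ) ∈ S :=
  (h x y t fun f hf => J_sign (hc f hf) hy ht).1 hyS

/-- Tarski–Seidenberg. -/
theorem SA.exists_real {T : (Fin n → ℝ) → ℝ → Prop} (hT : SA2 T) : SA (fun x => ∃ y, T x y) := by
  obtain ⟨F, hF, hs⟩ := exists_signFam hT
  obtain ⟨κ, _, ξ, hξ, hc⟩ := exists_cover hF
  refine ((SA.ex fun j => (hξ j).at hT).or (SA.ex fun α => (cG_place hξ α).sa2 hT)).congr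
    fun x => ?_
  constructor
  · rintro ⟨y, hy⟩
    rw [decide_iff hξ (T := T x) (x := x) (fun α y hy t ht h => by
      have := hs.J (fun f hf => hc f hf x) α y hy t ht (by simpa using h)
      simpa using this) y] at hy
    rcases hy with ⟨j, -, h⟩ | ⟨α, -, h⟩
    · left; exact ⟨j, h⟩
    · right; exact ⟨α, h⟩
  · rintro (⟨j, h⟩ | ⟨α, h⟩)
    · exact ⟨_, h⟩
    · have := (cG_place hξ α).ne x
      exact h.exists

/-! ### Closure -/

lemma SA.subst_one {T : (Fin n → ℝ) → ℝ → Prop} (hT : SA2 T) (i : Fin n) :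
    SA2 (fun x ε => ∃ t, (t - x i) ^ 2 < ε ^ 2 ∧ T (Function.update x i t) ε) := by
  apply SA.exists_real (n := n + 1)
  have h1 : SA (fun w : Fin (n + 1 + 1) → ℝ => 0 < (w 1) ^ 2 - (w 0 - w (i.succ.succ)) ^ 2) :=
    (SA.pos (MvPolynomial.X 1 ^ 2 - (MvPolynomial.X 0 - MvPolynomial.X (i.succ.succ)) ^ 2)).congr
      fun w => by simp
  have h2 := SA.preimage (k := n + 1 + 1) hT
    (Fin.cons (MvPolynomial.X 1) fun j => MvPolynomial.X (if j = i then 0 else j.succ.succ))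
  refine (h1.and h2).congr fun w => ?_
  refine and_congr ?_ ?_
  · rw [sub_pos]; rfl
  · apply Iff.of_eq
    simp only [Fin.cons_zero, MvPolynomial.eval_X]
    congr 1
    funext j
    by_cases hj : j = i
    · subst hj; simp [Fin.tail]
    · simp [Fin.tail, Function.update, hj]

lemma SA.thicken {s : Set (Fin n → ℝ)} (hs : IsSemialgebraic s) (A : Finset (Fin n)) :
    SA2 (fun x ε => ∃ y ∈ s, (∀ i ∈ A, (y i - x i) ^ 2 < ε ^ 2) ∧ ∀ i ∉ A, y i = x i) := by
  induction A using Finset.induction_on with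
  | empty =>
    refine (SA.lift (p := fun x => x ∈ s) hs).congr fun x ε => ?_
    constructor
    · rintro ⟨y, hy, -, h⟩
      have : y = x := funext fun i => h i (by simp)
      rwa [← this]
    · intro hx; exact ⟨x, hx, by simp, by simp⟩
  | insert i A hi ih =>
    refine (SA.subst_one ih i).congr fun x ε => ?_
    constructor
    · rintro ⟨y, hy, h1, h2⟩
      refine ⟨y i, h1 i (by simp), y, hy, fun j hj => ?_, fun j hj => ?_⟩
      · have : j ≠ i := fun h => hi (h ▸ hj)
        rw [Function.update_of_ne this]
        exact h1 j (by simp [hj])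
      · by_cases hji : j = i
        · subst hji; simp
        · rw [Function.update_of_ne hji]; exact h2 j (by simp [hji, hj])
    · rintro ⟨t, ht, y, hy, h1, h2⟩
      have hyi : y i = t := by simpa using h2 i hi
      refine ⟨y, hy, fun j hj => ?_, fun j hj => ?_⟩
      · rcases Finset.mem_insert.1 hj with rfl | hj
        · rw [hyi]; exact ht
        · have : j ≠ i := fun h => hi (h ▸ hj)
          have := h1 j hj
          rwa [Function.update_of_ne ‹j ≠ i›] at this
      · rw [Finset.mem_insert, not_or] at hj
        have := h2 j hj.2
        rwa [Function.update_of_ne hj.1] at this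

theorem isSemialgebraic_closure {s : Set (Fin n → ℝ)} (hs : IsSemialgebraic s) :
    IsSemialgebraic (closure s) := by
  have h1 := SA.thicken hs Finset.univ
  have h2 : SA2 (fun (_ : Fin n → ℝ) ε => 0 < ε) := (SA2.pos X).congr fun x y => by simp [ev]
  have h4 : SA2 (fun (x : Fin n → ℝ) ε => 0 < ε ∧ ¬ ∃ y ∈ s,
      (∀ i ∈ Finset.univ, (y i - x i) ^ 2 < ε ^ 2) ∧
        ∀ i ∉ (Finset.univ : Finset (Fin n)), y i = x i) := SA.and h2 (SA.not h1)
  have h3 := SA.not (SA.exists_real h4)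
  refine SA.congr (p := _) (q := fun x => x ∈ closure s) h3 fun x => ?_
  rw [Metric.mem_closure_iff]
  push Not
  refine forall_congr' fun ε => forall_congr' fun hε => exists_congr fun y => and_congr_right
    fun _ => ?_
  rw [dist_comm, dist_pi_lt_iff hε]
  simp only [Finset.mem_univ, true_imp_iff, not_true_eq_false, false_imp_iff, implies_true,
    and_true]
  refine forall_congr' fun i => ?_
  rw [Real.dist_eq, sq_lt_sq, abs_of_pos hε]

theorem isSemialgebraic_interior {s : Set (Fin n → ℝ)} (hs : IsSemialgebraic s) :
    IsSemialgebraic (interior s) := by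
  rw [interior_eq_compl_closure_compl]
  exact (isSemialgebraic_closure hs.compl).compl

/-! ### Decomposition into connected pieces -/

/-- finite union of connected semialgebraic sets -/
def Dec (S : Set (Fin n → ℝ)) : Prop :=
  ∃ 𝒞 : Set (Set (Fin n → ℝ)), 𝒞.Finite ∧ (∀ C ∈ 𝒞, IsSemialgebraic C ∧ IsPreconnected C) ∧
    ⋃₀ 𝒞 = S

lemma Dec.iUnion {ι : Type*} [Finite ι] {T : ι → Set (Fin n → ℝ)} (h : ∀ i, Dec (T i)) :
    Dec (⋃ i, T i) := by
  choose 𝒞 h1 h2 h3 using h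
  refine ⟨⋃ i, 𝒞 i, Set.finite_iUnion h1, ?_, ?_⟩
  · intro C hC
    obtain ⟨i, hi⟩ := Set.mem_iUnion.1 hC
    exact h2 i C hi
  · rw [Set.sUnion_iUnion]; simp only [h3]

lemma Dec.union {S T : Set (Fin n → ℝ)} (hS : Dec S) (hT : Dec T) : Dec (S ∪ T) := by
  have := Dec.iUnion (T := fun b : Bool => cond b S T) (by rintro (_ | _); exacts [hT, hS])
  rwa [← Set.union_eq_iUnion] at this

lemma Dec.cyl {B : Set (Fin n → ℝ)} (hB : Dec B) {T : (Fin n → ℝ) → ℝ → Prop} (hT : SA2 T)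
    (h : ∀ C ⊆ B, IsPreconnected C →
      IsPreconnected {z : Fin (n + 1) → ℝ | Fin.tail z ∈ C ∧ T (Fin.tail z) (z 0)}) :
    Dec {z : Fin (n + 1) → ℝ | Fin.tail z ∈ B ∧ T (Fin.tail z) (z 0)} := by
  obtain ⟨𝒞, h1, h2, h3⟩ := hB
  refine ⟨(fun C => {z : Fin (n + 1) → ℝ | Fin.tail z ∈ C ∧ T (Fin.tail z) (z 0)}) '' 𝒞,
    h1.image _, ?_, ?_⟩
  · rintro _ ⟨C, hC, rfl⟩
    refine ⟨SA.and (SA.lift (p := fun x => x ∈ C) (h2 C hC).1) hT, h C ?_ (h2 C hC).2⟩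
    rw [← h3]; exact Set.subset_sUnion_of_mem hC
  · ext z
    rw [← h3]
    simp only [Set.sUnion_image, Set.mem_iUnion, Set.mem_ofPred_eq, Set.mem_sUnion, exists_prop]
    constructor
    · rintro ⟨C, hC, h, h'⟩; exact ⟨⟨C, hC, h⟩, h'⟩
    · rintro ⟨⟨C, hC, h⟩, h'⟩; exact ⟨C, hC, h, h'⟩

lemma cons_continuousOn {C : Set (Fin n → ℝ)} {s : (Fin n → ℝ) → ℝ} (hs : ContinuousOn s C) :
    ContinuousOn (fun x => (Fin.cons (s x) x : Fin (n + 1) → ℝ)) C := by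
  rw [continuousOn_pi]
  intro i
  refine Fin.cases ?_ (fun j => ?_) i
  · simpa using hs
  · simpa using (continuous_apply j).continuousOn

lemma graph_preconnected {C : Set (Fin n → ℝ)} (hC : IsPreconnected C) {s : (Fin n → ℝ) → ℝ}
    (hs : ContinuousOn s C) :
    IsPreconnected {z : Fin (n + 1) → ℝ | Fin.tail z ∈ C ∧ z 0 = s (Fin.tail z)} := by
  have := hC.image _ (cons_continuousOn hs)
  convert this using 1
  ext z
  constructor
  · rintro ⟨h1, h2⟩
    refine ⟨Fin.tail z, h1, ?_⟩
    simp only [← h2, Fin.cons_self_tail]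
  · rintro ⟨x, hx, rfl⟩
    simpa using hx

lemma band_preconnected {C : Set (Fin n → ℝ)} (hC : IsPreconnected C) {s : (Fin n → ℝ) → ℝ}
    (hs : ContinuousOn s C) {I : (Fin n → ℝ) → Set ℝ} (hI : ∀ x ∈ C, (I x).OrdConnected)
    (hsI : ∀ x ∈ C, s x ∈ I x) :
    IsPreconnected {z : Fin (n + 1) → ℝ | Fin.tail z ∈ C ∧ z 0 ∈ I (Fin.tail z)} := by
  set G := {z : Fin (n + 1) → ℝ | Fin.tail z ∈ C ∧ z 0 = s (Fin.tail z)} with hG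
  have hGp : IsPreconnected G := graph_preconnected hC hs
  have hfib : ∀ x ∈ C, IsPreconnected ((fun y => (Fin.cons y x : Fin (n + 1) → ℝ)) '' (I x)) := by
    intro x hx
    refine IsPreconnected.image (hI x hx).isPreconnected _ (Continuous.continuousOn ?_)
    exact Continuous.finCons continuous_id continuous_const
  have hu : ∀ x ∈ C, IsPreconnected (G ∪ (fun y => (Fin.cons y x : Fin (n + 1) → ℝ)) '' (I x)) := by
    intro x hx
    refine IsPreconnected.union (Fin.cons (s x) x) ?_ ?_ hGp (hfib x hx)
    · exact ⟨by simpa using hx, by simp⟩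
    · exact ⟨s x, hsI x hx, rfl⟩
  rcases Set.eq_empty_or_nonempty C with rfl | ⟨x0, hx0⟩
  · simp [isPreconnected_empty]
  · refine isPreconnected_of_forall (Fin.cons (s x0) x0) ?_
    rintro z ⟨hz1, hz2⟩
    refine ⟨_, ?_, ?_, ?_, hu (Fin.tail z) hz1⟩
    · rintro w (⟨hw1, hw2⟩ | ⟨y, hy, rfl⟩)
      · exact ⟨hw1, by rw [hw2]; exact hsI _ hw1⟩
      · exact ⟨by simpa using hz1, by simpa using hy⟩
    · left; exact ⟨by simpa using hx0, by simp⟩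
    · right; exact ⟨z 0, hz2, by simp⟩

/-! ### Continuity of the roots -/

lemma chain_eq {ι : Type*} [Finite ι] (v : ι → ℝ) (l : ι → ι)
    (h : ∀ j k, v j < v k → v (l j) < v (l k)) (i : ι) : ¬ v i < v (l i) := by
  intro hi
  have hm : StrictMono fun m => v (l^[m] i) := by
    apply strictMono_nat_of_lt_succ
    intro m
    induction m with
    | zero => simpa using hi
    | succ m ih =>
      simp only [Function.iterate_succ', Function.comp] at ih ⊢
      exact h _ _ ih
  have hinj : Function.Injective fun m => l^[m] i := fun a b hab =>
    hm.injective (congrArg v hab)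
  exact not_injective_infinite_finite _ hinj

lemma chain_eq' {ι : Type*} [Finite ι] (v : ι → ℝ) (l : ι → ι)
    (h : ∀ j k, v j < v k → v (l j) < v (l k)) (i : ι) : v (l i) = v i := by
  apply le_antisymm
  · exact not_lt.1 (chain_eq v l h i)
  · have := chain_eq (fun i => - v i) l (fun j k hjk => by
      have := h k j (by linarith)
      linarith) i
    linarith

/-- zeros of the family -/
def Z (F : Set (MvPolynomial (Fin n) ℝ)[X]) (x : Fin n → ℝ) : Set ℝ :=
  {y | ∃ f ∈ F, ev f x ≠ 0 ∧ (ev f x).eval y = 0}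

lemma exists_simple {F : Set (MvPolynomial (Fin n) ℝ)[X]}
    (hF : ∀ f ∈ F, derivative f ≠ 0 → derivative f ∈ F) {x : Fin n → ℝ} {y : ℝ}
    {f : (MvPolynomial (Fin n) ℝ)[X]} (hf : f ∈ F) (h0 : ev f x ≠ 0) (hy : (ev f x).eval y = 0) :
    ∃ g ∈ F, (ev g x).eval y = 0 ∧ (derivative (ev g x)).eval y ≠ 0 := by
  induction hd : (ev f x).natDegree using Nat.strong_induction_on generalizing f with
  | _ d ih =>
    by_cases h1 : (derivative (ev f x)).eval y = 0
    · have hnd : (ev f x).natDegree ≠ 0 := by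
        intro h
        rw [Polynomial.eq_C_of_natDegree_eq_zero h] at hy h0
        simp only [eval_C] at hy
        rw [hy] at h0
        simp at h0
      have hd0 : derivative (ev f x) ≠ 0 := by
        intro h
        exact hnd (Polynomial.derivative_eq_zero.1 h)
      have e : derivative (ev f x) = ev (derivative f) x := by simp [ev, Polynomial.derivative_map]
      have hlt := Polynomial.natDegree_derivative_lt hnd
      rw [e] at h1 hd0 hlt
      refine ih _ (by rw [← hd]; exact hlt) (hF f hf ?_) hd0 h1 rfl
      intro h
      rw [h] at hd0
      simp [ev] at hd0
    · exact ⟨f, hf, hy, h1⟩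

lemma sign_change {p : ℝ[X]} {a : ℝ} (h0 : p.eval a = 0) (h1 : (derivative p).eval a ≠ 0) :
    ∀ᶠ η in 𝓝[>] (0 : ℝ), p.eval (a - η) * p.eval (a + η) < 0 := by
  obtain ⟨q, rfl⟩ := Polynomial.dvd_iff_isRoot.2 h0
  have hq : q.eval a ≠ 0 := by simpa using h1
  have hc : Continuous fun η : ℝ => q.eval (a - η) * q.eval (a + η) :=
    ((cont q).comp (continuous_const.sub continuous_id)).mul
      ((cont q).comp (continuous_const.add continuous_id))
  have hpos : ∀ᶠ η in 𝓝 (0 : ℝ), 0 < q.eval (a - η) * q.eval (a + η) := by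
    apply hc.continuousAt.eventually_const_lt
    simpa using mul_self_pos.2 hq
  filter_upwards [nhdsWithin_le_nhds hpos, self_mem_nhdsWithin] with η h hη
  have hη' : 0 < η := hη
  simp only [eval_mul, eval_sub, eval_X, eval_C]
  have : (a - η - a) * q.eval (a - η) * ((a + η - a) * q.eval (a + η))
    = -(η ^ 2 * (q.eval (a - η) * q.eval (a + η))) := by ring
  rw [this]
  have := mul_pos (pow_pos hη' 2) h
  linarith

lemma ev_continuous (g : (MvPolynomial (Fin n) ℝ)[X]) (y : ℝ) :
    Continuous fun x => (ev g x).eval y := by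
  simp only [ev_symm]
  exact (MvPolynomial.continuous_eval _).comp (Continuous.finCons continuous_const continuous_id)

lemma Z_lower {F : Set (MvPolynomial (Fin n) ℝ)[X]}
    (hF : ∀ f ∈ F, derivative f ≠ 0 → derivative f ∈ F) {x0 : Fin n → ℝ} {a : ℝ}
    (ha : a ∈ Z F x0) {δ : ℝ} (hδ : 0 < δ) : ∀ᶠ x in 𝓝 x0, ∃ y ∈ Z F x, |y - a| < δ := by
  obtain ⟨f, hf, h0, hy⟩ := ha
  obtain ⟨g, hg, hg0, hg1⟩ := exists_simple hF hf h0 hy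
  have e2 : ∀ᶠ η in 𝓝[>] (0 : ℝ), η < δ := nhdsWithin_le_nhds (eventually_lt_nhds hδ)
  have e3 : ∀ᶠ η in 𝓝[>] (0 : ℝ), 0 < η := self_mem_nhdsWithin
  obtain ⟨η, h1, h2, h3⟩ := ((sign_change hg0 hg1).and (e2.and e3)).exists
  have hev : ∀ᶠ x in 𝓝 x0, (ev g x).eval (a - η) * (ev g x).eval (a + η) < 0 :=
    ((ev_continuous g _).mul (ev_continuous g _)).continuousAt.eventually_lt_const h1
  filter_upwards [hev] with x hx
  have hg0 : ev g x ≠ 0 := by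
    intro h; rw [h] at hx; simp at hx
  by_contra hcon
  push Not at hcon
  have := same_sign (p := ev g x) (a := a - η) (b := a + η) (by
    intro c hc h
    rw [Set.uIcc_of_le (by linarith)] at hc
    have := hcon c ⟨g, hg, hg0, h⟩
    have h4 : |c - a| ≤ η := by rw [abs_le]; constructor <;> linarith [hc.1, hc.2]
    linarith)
  rcases mul_neg_iff.1 hx with ⟨h4, h5⟩ | ⟨h4, h5⟩
  · exact absurd (this.1 h4) h5.le.not_gt
  · exact absurd (this.2 h5) h4.le.not_gt

/-- stratum -/
def Str (F : Set (MvPolynomial (Fin n) ℝ)[X]) (ξ : κ → (Fin n → ℝ) → ℝ)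
    (R : κ → κ → Prop) (I : κ → Prop) : Set (Fin n → ℝ) :=
  {x | (∀ i j, ξ i x < ξ j x ↔ R i j) ∧ ∀ i, (ξ i x ∈ Z F x ↔ I i)}

lemma Str_sa [Finite κ] {F : Set (MvPolynomial (Fin n) ℝ)[X]} (hF : F.Finite)
    {ξ : κ → (Fin n → ℝ) → ℝ} (hξ : ∀ i, SAFun (ξ i)) (R : κ → κ → Prop) (I : κ → Prop) :
    SA (fun x => x ∈ Str F ξ R I) :=
  (SA.all fun i => SA.all fun j => ((hξ i).at (hξ j).lt).iff (SA.const _)).and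
    (SA.all fun i => (SA.bex hF fun f _ => (SA_ev_ne f).and ((hξ i).at (SA2.eq0 f))).iff
      (SA.const _))

lemma Str_cont [Finite κ] {F : Set (MvPolynomial (Fin n) ℝ)[X]}
    (hF : ∀ f ∈ F, derivative f ≠ 0 → derivative f ∈ F)
    {ξ : κ → (Fin n → ℝ) → ℝ} (hc : ∀ f ∈ F, Covers ξ f) (R : κ → κ → Prop) (I : κ → Prop)
    (i : κ) (hi : I i) : ContinuousOn (ξ i) (Str F ξ R I) := by
  intro x0 hx0
  rw [ContinuousWithinAt, Metric.tendsto_nhds]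
  intro ε hε
  have e1 : ∀ᶠ δ in 𝓝[>] (0 : ℝ), ∀ j k, ξ j x0 < ξ k x0 → δ < (ξ k x0 - ξ j x0) / 2 := by
    simp only [Filter.eventually_all]
    intro j k hjk
    exact nhdsWithin_le_nhds (eventually_lt_nhds (by linarith))
  have e2 : ∀ᶠ δ in 𝓝[>] (0 : ℝ), δ < ε := nhdsWithin_le_nhds (eventually_lt_nhds hε)
  have e3 : ∀ᶠ δ in 𝓝[>] (0 : ℝ), 0 < δ := self_mem_nhdsWithin
  obtain ⟨δ, hδ1, hδ2, hδ3⟩ := (e1.and (e2.and e3)).exists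
  have key : ∀ᶠ x in 𝓝 x0, ∀ j : {j // I j}, ∃ y ∈ Z F x, |y - ξ j x0| < δ := by
    rw [Filter.eventually_all]
    intro j
    exact Z_lower hF ((hx0.2 j).2 j.2) hδ3
  filter_upwards [nhdsWithin_le_nhds key, self_mem_nhdsWithin] with x hx hxS
  have : ∀ j : {j // I j}, ∃ l : {j // I j}, |ξ l x - ξ j x0| < δ := by
    intro j
    obtain ⟨y, hy, hyd⟩ := hx j
    obtain ⟨f, hf, h0, hfy⟩ := id hy
    obtain ⟨l, rfl⟩ := hc f hf x h0 y hfy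
    exact ⟨⟨l, (hxS.2 l).1 hy⟩, hyd⟩
  choose l hl using this
  have hmain := chain_eq' (fun j : {j // I j} => ξ j x) l (fun j k hjk => by
    have h1 : ξ j x0 < ξ k x0 := (hx0.1 j k).2 ((hxS.1 j k).1 hjk)
    have h2 := hδ1 j k h1
    have h3 := abs_lt.1 (hl j)
    have h4 := abs_lt.1 (hl k)
    linarith [h3.2, h4.1]) ⟨i, hi⟩
  simp only at hmain
  have := hl ⟨i, hi⟩
  rw [hmain] at this
  rw [Real.dist_eq]
  exact this.trans hδ2

/-! ### Sections of bands -/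

lemma exists_above {C : Set (Fin n → ℝ)} {a : (Fin n → ℝ) → ℝ} (ha : ContinuousOn a C)
    {ξ : κ → (Fin n → ℝ) → ℝ} (hξ : ∀ j, ContinuousOn (ξ j) C) (N : Finset κ)
    (h : ∀ j ∈ N, ∀ x ∈ C, a x < ξ j x) :
    ∃ m : (Fin n → ℝ) → ℝ, ContinuousOn m C ∧ ∀ x ∈ C, a x < m x ∧ ∀ j ∈ N, m x ≤ ξ j x := by
  classical
  induction N using Finset.induction_on with
  | empty => exact ⟨fun x => a x + 1, ha.add continuousOn_const, fun x _ => ⟨by simp, by simp⟩⟩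
  | insert j N _ ih =>
    obtain ⟨m, hm, hm'⟩ := ih fun k hk => h k (by simp [hk])
    refine ⟨fun x => min (m x) (ξ j x), continuous_min.comp_continuousOn (hm.prodMk (hξ j)), fun x hx => ⟨?_, ?_⟩⟩
    · exact lt_min (hm' x hx).1 (h j (by simp) x hx)
    · intro k hk
      rcases Finset.mem_insert.1 hk with rfl | hk
      · exact min_le_right _ _
      · exact (min_le_left _ _).trans ((hm' x hx).2 k hk)

lemma exists_section [Finite κ] {C : Set (Fin n → ℝ)} {ξ : κ → (Fin n → ℝ) → ℝ}
    (hξ : ∀ j, ContinuousOn (ξ j) C) {R : κ → κ → Prop}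
    (hR : ∀ x ∈ C, ∀ i j, ξ i x < ξ j x ↔ R i j) (α : Option κ) :
    ∃ s : (Fin n → ℝ) → ℝ, ContinuousOn s C ∧ ∀ x ∈ C, s x ∈ J ξ α x := by
  classical
  have := Fintype.ofFinite κ
  cases α with
  | none =>
    refine ⟨fun x => -(∑ j, |ξ j x|) - 1,
      ((continuousOn_finsetSum _ fun j _ => (hξ j).abs).neg).sub continuousOn_const, ?_⟩
    intro x _
    refine ⟨trivial, fun j _ => ?_⟩
    have := Finset.single_le_sum (f := fun j => |ξ j x|) (fun j _ => abs_nonneg _)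
      (Finset.mem_univ j)
    have h2 := neg_abs_le (ξ j x)
    linarith
  | some i =>
    obtain ⟨m, hm, hm'⟩ := exists_above (hξ i) hξ (Finset.univ.filter fun j => R i j) (by
      intro j hj x hx
      exact (hR x hx i j).2 (Finset.mem_filter.1 hj).2)
    refine ⟨fun x => (ξ i x + m x) / 2, ((hξ i).add hm).div_const _, fun x hx => ?_⟩
    obtain ⟨h1, h2⟩ := hm' x hx
    refine ⟨?_, fun j hj => ?_⟩
    · change ξ i x < _
      linarith
    · have := h2 j (Finset.mem_filter.2 ⟨Finset.mem_univ _, (hR x hx i j).1 hj⟩)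
      linarith

/-! ### Main decomposition -/

lemma exists_closed {F : Set (MvPolynomial (Fin n) ℝ)[X]} (hF : F.Finite) :
    ∃ G : Set (MvPolynomial (Fin n) ℝ)[X], F ⊆ G ∧ G.Finite ∧
      ∀ f ∈ G, derivative f ≠ 0 → derivative f ∈ G := by
  refine ⟨⋃ f ∈ F, (fun k => derivative^[k] f) '' Set.Iic f.natDegree, ?_, ?_, ?_⟩
  · intro f hf
    exact Set.mem_biUnion hf ⟨0, by simp, rfl⟩
  · exact hF.biUnion fun f _ => (Set.finite_Iic _).image _
  · intro g hg h0
    simp only [Set.mem_iUnion, Set.mem_image, Set.mem_Iic] at hg ⊢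
    obtain ⟨f, hf, k, hk, rfl⟩ := hg
    rw [← Function.iterate_succ_apply' (f := (derivative : (MvPolynomial (Fin n) ℝ)[X] → _))] at h0 ⊢
    refine ⟨f, hf, k + 1, ?_, rfl⟩
    by_contra hc
    exact h0 (Polynomial.iterate_derivative_eq_zero (not_le.1 hc))

theorem dec_all (n : ℕ) (S : Set (Fin n → ℝ)) (hS : IsSemialgebraic S) : Dec S := by
  induction n with
  | zero =>
    exact ⟨{S}, Set.finite_singleton _, by
      rintro C rfl
      exact ⟨hS, (Set.subsingleton_of_subsingleton).isPreconnected⟩, by simp⟩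
  | succ n ih =>
    obtain ⟨F0, hF0, hs0⟩ := exists_signFam hS
    obtain ⟨F, hF0F, hF, hFd⟩ := exists_closed hF0
    have hs : SignFam S F := fun x y t h => hs0 x y t fun f hf => h f (hF0F hf)
    obtain ⟨κ, _, ξ, hξ, hc⟩ := exists_cover hF
    have hS2 := SA2.of_set hS
    -- pieces
    let ξ' : (I : κ → Prop) → {i // I i} → (Fin n → ℝ) → ℝ := fun I i => ξ i.1
    have hξ' : ∀ I i, SAFun (ξ' I i) := fun I i => hξ i.1
    let g : (σ : (κ → κ → Prop) × (κ → Prop)) → {i // σ.2 i} → Set (Fin n → ℝ) := fun σ i =>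
      {x | x ∈ Str F ξ σ.1 σ.2 ∧ (Fin.cons (ξ i.1 x) x : Fin (n + 1) → ℝ) ∈ S}
    let b : (σ : (κ → κ → Prop) × (κ → Prop)) → Option {i // σ.2 i} → Set (Fin n → ℝ) :=
      fun σ α => {x | x ∈ Str F ξ σ.1 σ.2 ∧
        ∀ᶠ t in cG (ξ' σ.2) α x, (Fin.cons t x : Fin (n + 1) → ℝ) ∈ S}
    have hcont : ∀ (σ : (κ → κ → Prop) × (κ → Prop)) (i : {i // σ.2 i}),
        ContinuousOn (ξ' σ.2 i) (Str F ξ σ.1 σ.2) := fun σ i => Str_cont hFd hc _ _ i.1 i.2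
    have hg : ∀ σ i, Dec {z : Fin (n + 1) → ℝ | Fin.tail z ∈ g σ i ∧ z 0 = ξ i.1 (Fin.tail z)} := by
      intro σ i
      refine (ih _ ((Str_sa hF hξ _ _).and ((hξ i.1).at hS2))).cyl (hξ i.1).eq ?_
      intro C hC hCp
      exact graph_preconnected hCp ((hcont σ i).mono fun x hx => (hC hx).1)
    have hb : ∀ σ α, Dec {z : Fin (n + 1) → ℝ | Fin.tail z ∈ b σ α ∧
        z 0 ∈ J (ξ' σ.2) α (Fin.tail z)} := by
      intro σ α
      refine (ih _ ((Str_sa hF hξ _ _).and ((cG_place (hξ' σ.2) α).sa2 hS2))).cyl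
        (J_sa (hξ' σ.2) α) ?_
      intro C hC hCp
      obtain ⟨s, hs1, hs2⟩ := exists_section (C := C) (ξ := ξ' σ.2)
        (R := fun i j => σ.1 i.1 j.1)
        (fun j => (hcont σ j).mono fun x hx => (hC hx).1)
        (fun x hx i j => (hC hx).1.1 i.1 j.1) α
      exact band_preconnected hCp hs1 (fun x _ => J_ord) hs2
    have hD := Dec.iUnion fun σ => (Dec.iUnion fun i => hg σ i).union (Dec.iUnion fun α => hb σ α)
    convert hD using 1
    -- constancy on bands
    have hcJ : ∀ σ : (κ → κ → Prop) × (κ → Prop), ∀ x ∈ Str F ξ σ.1 σ.2, ∀ f ∈ F, ev f x ≠ 0 →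
        ∀ y, (ev f x).eval y = 0 → ∃ j, y = ξ' σ.2 j x := by
      intro σ x hx f hf h0 y hy
      obtain ⟨j, rfl⟩ := hc f hf x h0 y hy
      exact ⟨⟨j, (hx.2 j).1 ⟨f, hf, h0, hy⟩⟩, rfl⟩
    ext z
    obtain ⟨x, y, rfl⟩ : ∃ (x : Fin n → ℝ) (y : ℝ), z = (Fin.cons y x : Fin (n + 1) → ℝ) :=
      ⟨Fin.tail z, z 0, by simp⟩
    simp only [Set.mem_iUnion, Set.mem_union, Set.mem_ofPred_eq, Fin.tail_cons, Fin.cons_zero]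
    constructor
    · intro hz
      let σ : (κ → κ → Prop) × (κ → Prop) := (fun i j => ξ i x < ξ j x, fun i => ξ i x ∈ Z F x)
      have hσ : x ∈ Str F ξ σ.1 σ.2 := ⟨fun i j => Iff.rfl, fun i => Iff.rfl⟩
      refine ⟨σ, ?_⟩
      rcases J_cover (ξ' σ.2) x y with ⟨j, rfl⟩ | ⟨α, hα⟩
      · left; exact ⟨j, ⟨hσ, hz⟩, rfl⟩
      · right
        refine ⟨α, ⟨hσ, ?_⟩, hα⟩
        filter_upwards [cG_J (ξ' σ.2) α x] with t ht
        exact hs.J (hcJ σ x hσ) α y hα t ht hz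
    · rintro ⟨σ, ⟨j, ⟨-, h⟩, rfl⟩ | ⟨α, ⟨hσ, h⟩, hα⟩⟩
      · exact h
      · have := (cG_place (hξ' σ.2) α).ne x
        obtain ⟨t, ht, htJ⟩ := (h.and (cG_J (ξ' σ.2) α x)).exists
        exact hs.J (hcJ σ x hσ) α t htJ y hα ht

lemma component_eq {S : Set (Fin n → ℝ)} {𝒞 : Set (Set (Fin n → ℝ))}
    (h2 : ∀ C ∈ 𝒞, IsPreconnected C) (h3 : ⋃₀ 𝒞 = S) (x : Fin n → ℝ) :
    connectedComponentIn S x = ⋃₀ {C ∈ 𝒞 | C ⊆ connectedComponentIn S x} := by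
  apply Set.Subset.antisymm
  · intro y hy
    have hyS := connectedComponentIn_subset S x hy
    obtain ⟨C, hC, hyC⟩ := Set.mem_sUnion.1 (h3.symm ▸ hyS)
    refine ⟨C, ⟨hC, ?_⟩, hyC⟩
    rw [connectedComponentIn_eq hy]
    exact (h2 C hC).subset_connectedComponentIn hyC (h3 ▸ Set.subset_sUnion_of_mem hC)
  · exact Set.sUnion_subset fun C hC => hC.2

end SAlg

/-- the closure, the interior, and each connected component of a
semialgebraic subset of `ℝⁿ` are semialgebraic, and a semialgebraic set has only finitely
many connected components. -/
theorem semialgebraic_closure_interior_components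
    {n : ℕ} (s : Set (Fin n → ℝ)) (hs : IsSemialgebraic s) :
    IsSemialgebraic (closure s) ∧
    IsSemialgebraic (interior s) ∧
    (∀ x ∈ s, IsSemialgebraic (connectedComponentIn s x)) ∧
    {C : Set (Fin n → ℝ) | ∃ x ∈ s, C = connectedComponentIn s x}.Finite := by
  refine ⟨SAlg.isSemialgebraic_closure hs, SAlg.isSemialgebraic_interior hs, ?_, ?_⟩
  · intro x _
    obtain ⟨𝒞, h1, h2, h3⟩ := SAlg.dec_all n s hs
    rw [SAlg.component_eq (fun C hC => (h2 C hC).2) h3 x]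
    have h := SAlg.SA.bex (h1.subset (Set.sep_subset 𝒞
      (fun C => C ⊆ connectedComponentIn s x))) (p := fun C y => y ∈ C)
      (fun C hC => (h2 C hC.1).1)
    exact h
  · obtain ⟨𝒞, h1, h2, h3⟩ := SAlg.dec_all n s hs
    refine (h1.finite_subsets.image Set.sUnion).subset ?_
    rintro C ⟨x, -, rfl⟩
    exact ⟨{C ∈ 𝒞 | C ⊆ connectedComponentIn s x}, Set.sep_subset _ _,
      (SAlg.component_eq (fun C hC => (h2 C hC).2) h3 x).symm⟩
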